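/- Law of order estimation, Case II with m odd, ε = 1 and δ = −1: if the characteristic exponent m is an odd positive integer, ε = 1 and δ = −1, then the averaged T¹-type quantity satisfies ⟨A⟩(Δr) = O(Δr^{m+1}) as Δr → 0⁺, i.e. Δr^{−(m+1)}·⟨A⟩(Δr) stays bounded for small Δr > 0. -/

import Mathlib

open Filter Finset

noncomputable section

/-- Transition probability η on trits: η(0) = (β/2)(1 − Pe/2), η(1) = 1 − β,
η(2) = (β/2)(1 + Pe/2). -/
def eta (β Pe : ℝ) (ω : Fin 3) : ℝ :=
  if (ω : ℕ) = 0 then β / 2 * (1 - Pe / 2)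
  else if (ω : ℕ) = 1 then 1 - β
  else β / 2 * (1 + Pe / 2)

/-- ν(ω) = η(2 − ω). -/
def nu (β Pe : ℝ) (ω : Fin 3) : ℝ :=
  if (ω : ℕ) = 0 then β / 2 * (1 + Pe / 2)
  else if (ω : ℕ) = 1 then 1 - β
  else β / 2 * (1 - Pe / 2)

/-- Bulk local density ρ̂ⱼ(u′) = (∏ η(u_d)/ν(u_d)) · ρ₀(r + (j + Σ (1 − u_d))·Δr). -/
def rhoHat (β Pe r Δr : ℝ) (ρ₀ : ℝ → ℝ) {K : ℕ} (j : ℤ) (u : Fin K → Fin 3) : ℝ :=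
  (∏ d, eta β Pe (u d) / nu β Pe (u d)) *
    ρ₀ (r + ((j : ℝ) + ∑ d, (1 - ((u d : ℕ) : ℝ))) * Δr)

/-- F_j(ω, u) with u = u₀u′ :
F_j(ω,u) = f((η(ω)/ν(ω))·ρ̂_j(u′), (η(u₀)/ν(u₀))·ρ̂_{j+1−u₀}(u′)). -/
def Floc (β Pe r Δr : ℝ) (ρ₀ : ℝ → ℝ) (f : ℝ → ℝ → ℝ) {K : ℕ}
    (j : ℤ) (ω u₀ : Fin 3) (u' : Fin K → Fin 3) : ℝ :=
  f (eta β Pe ω / nu β Pe ω * rhoHat β Pe r Δr ρ₀ j u')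
    (eta β Pe u₀ / nu β Pe u₀ * rhoHat β Pe r Δr ρ₀ (j + 1 - ((u₀ : ℕ) : ℤ)) u')

/-- K(Δr): the sum over the trit ω and the k-digit trit string u = u₀u′. -/
def Ksum (D v β r : ℝ) (k : ℕ) (ρ₀ : ℝ → ℝ) (f : ℝ → ℝ → ℝ)
    (ε δ : ℝ) (m : ℕ) (Δr : ℝ) : ℝ :=
  Δr * ∑ ω : Fin 3, ∑ u₀ : Fin 3, ∑ u' : Fin (k - 1) → Fin 3,
    (eta β (v * Δr / D) ω + δ * nu β (v * Δr / D) ω) *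
      (nu β (v * Δr / D) u₀ * ∏ d, nu β (v * Δr / D) (u' d)) *
      (Floc β (v * Δr / D) r Δr ρ₀ f 0 ω u₀ u' +
        ε * (-1 : ℝ) ^ m * Floc β (v * Δr / D) r Δr ρ₀ f (1 - ((ω : ℕ) : ℤ)) ω u₀ u')

/-- The spatio-temporally averaged T¹-type quantity ⟨A⟩(Δr) = K/(τ·Δr),
with τ = β·Δr²/(2D). -/
def avgA (D v β r : ℝ) (k : ℕ) (ρ₀ : ℝ → ℝ) (f : ℝ → ℝ → ℝ)
    (ε δ : ℝ) (m : ℕ) (Δr : ℝ) : ℝ :=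
  Ksum D v β r k ρ₀ f ε δ m Δr / (β * Δr ^ 2 / (2 * D) * Δr)

/-- f̃(X,Y) = f(Y + X, Y − X). -/
def ftilde (f : ℝ → ℝ → ℝ) (X Y : ℝ) : ℝ := f (Y + X) (Y - X)

open Asymptotics Topology

lemma isLittleO_sub_leading_taylor_term {g : ℝ → ℝ} {n : ℕ} (hg : ContDiffAt ℝ n g 0)
    (hz : ∀ i < n, iteratedDeriv i g 0 = 0) :
    (fun x => g x - iteratedDeriv n g 0 / n.factorial * x ^ n) =o[𝓝 0] fun x => x ^ n := by
  obtain ⟨u, hu, hgu⟩ := hg.contDiffOn le_rfl (by simp)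
  obtain ⟨a, ha, hau⟩ := Metric.mem_nhds_iff.1 hu
  have h0 : (0 : ℝ) ∈ Metric.ball (0 : ℝ) a := Metric.mem_ball_self ha
  have ht := taylor_isLittleO (convex_ball (0 : ℝ) a) h0 (hgu.mono hau)
  rw [Metric.isOpen_ball.nhdsWithin_eq h0] at ht
  simp only [sub_zero] at ht
  refine ht.congr_left fun x => ?_
  rw [taylor_within_apply, Finset.sum_range_succ, Finset.sum_eq_zero, zero_add,
    iteratedDerivWithin_of_isOpen Metric.isOpen_ball h0]
  · simp only [sub_zero, smul_eq_mul]; ring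
  · intro i hi
    rw [iteratedDerivWithin_of_isOpen Metric.isOpen_ball h0, hz i (Finset.mem_range.1 hi),
      smul_zero]

lemma iteratedDeriv_eq_zero_of_isLittleO {g : ℝ → ℝ} {n : ℕ} (hg : ContDiffAt ℝ n g 0)
    (ho : g =o[𝓝 0] fun x => x ^ n) : ∀ i ≤ n, iteratedDeriv i g 0 = 0 := by
  intro i
  induction i using Nat.strong_induction_on with
  | _ i ih =>
    intro hi
    have h1 := isLittleO_sub_leading_taylor_term (hg.of_le (by exact_mod_cast hi))
      (fun j hj => ih j hj (by omega))
    have h2 : g =o[𝓝 0] fun x => x ^ i := by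
      refine ho.trans_isBigO (IsBigO.of_bound 1 ?_)
      filter_upwards [Metric.closedBall_mem_nhds (0 : ℝ) one_pos] with x hx
      rw [norm_pow, norm_pow, one_mul]
      exact pow_le_pow_of_le_one (norm_nonneg x) (by simpa using hx) hi
    have h3 : (fun x : ℝ => iteratedDeriv i g 0 / i.factorial * x ^ i) =o[𝓝 0] fun x => x ^ i :=
      (h2.sub h1).congr_left fun x => by ring
    by_contra hne
    refine isLittleO_irrefl ?_ ((isLittleO_const_mul_left_iff
      (div_ne_zero hne (Nat.cast_ne_zero.2 i.factorial_ne_zero))).1 h3)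
    have hfr : ∃ᶠ x : ℝ in 𝓝 0, x ≠ 0 :=
      mem_closure_iff_frequently.1 (dense_compl_singleton (0 : ℝ) 0)
    exact hfr.mono fun x hx => pow_ne_zero _ hx

/-- A function of parity `(-1)ⁿ` that vanishes beyond order `n` at `0` vanishes to order `n + 2`. -/
lemma isBigO_pow_add_two_of_parity {g : ℝ → ℝ} {n : ℕ} (hg : ContDiffAt ℝ (n + 2 : ℕ) g 0)
    (ho : g =o[𝓝 0] fun x => x ^ n) (hpar : ∀ x, g (-x) = (-1) ^ n * g x) :
    g =O[𝓝 0] fun x => x ^ (n + 2) := by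
  have hlow := iteratedDeriv_eq_zero_of_isLittleO
    (hg.of_le (by exact_mod_cast Nat.le_add_right n 2)) ho
  have hnext : iteratedDeriv (n + 1) g 0 = 0 := by
    have h1 := iteratedDeriv_comp_neg (n + 1) g 0
    simp only [hpar, iteratedDeriv_const_mul_field, neg_zero, smul_eq_mul, pow_succ] at h1
    have h2 : ((-1 : ℝ) ^ n) * iteratedDeriv (n + 1) g 0 = 0 := by linarith
    simpa using h2
  have ht := isLittleO_sub_leading_taylor_term hg fun i hi => by
    rcases Nat.lt_or_ge n i with h | h
    · rwa [show i = n + 1 by omega]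
    · exact hlow i h
  exact (ht.isBigO.add (isBigO_const_mul_self
    (iteratedDeriv (n + 2) g 0 / (n + 2).factorial) _ _)).congr_left fun x => sub_add_cancel _ _

lemma abs_le_pow_of_iteratedDeriv_le {m : ℕ} {g : ℝ → ℝ} (hg : ContDiff ℝ m g)
    (hz : ∀ i < m, iteratedDeriv i g 0 = 0) {e a : ℝ} (he : 0 ≤ e)
    (hb : ∀ x, |x| ≤ a → |iteratedDeriv m g x| ≤ e) :
    ∀ x, |x| ≤ a → |g x| ≤ e * |x| ^ m := by
  induction m generalizing g with
  | zero => simpa using hb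
  | succ m ih =>
    intro x hx
    have hg' : ContDiff ℝ m (deriv g) := by
      have : ContDiff ℝ (m + 1) g := by exact_mod_cast hg
      exact (contDiff_succ_iff_deriv.1 this).2.2
    have h1 := ih hg' (fun i hi => by
      rw [← iteratedDeriv_succ']; exact hz _ (by omega)) (fun x hx => by
      rw [← iteratedDeriv_succ']; exact hb x hx)
    have hd : Differentiable ℝ g := hg.differentiable (by simp)
    have h0 : g 0 = 0 := by simpa using hz 0 (by omega)
    have := (convex_closedBall (0 : ℝ) |x|).norm_image_sub_le_of_norm_deriv_le (f := g)
      (C := e * |x| ^ m) (x := 0) (y := x) (fun y _ => hd y) (fun y hy => by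
        have hy' : |y| ≤ |x| := by simpa using hy
        refine (h1 y (hy'.trans hx)).trans ?_
        gcongr) (by simp) (by simp)
    simpa [h0, pow_succ, mul_assoc] using this

/-- The iterated derivatives along the first variable of a smooth function of two variables are
jointly continuous. -/
lemma continuous_iteratedDeriv_fst {G : ℝ × ℝ → ℝ} (hG : ContDiff ℝ (⊤ : ℕ∞) G) (m : ℕ) :
    Continuous fun p : ℝ × ℝ => iteratedDeriv m (fun x => G (x, p.2)) p.1 := by
  suffices h : ∃ H : ℝ × ℝ → ℝ, ContDiff ℝ (⊤ : ℕ∞) H ∧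
      ∀ y, iteratedDeriv m (fun x => G (x, y)) = fun x => H (x, y) by
    obtain ⟨H, hH, hGH⟩ := h
    simpa only [hGH] using hH.continuous
  induction m with
  | zero => exact ⟨G, hG, fun y => by simp⟩
  | succ m ih =>
    obtain ⟨H, hH, hGH⟩ := ih
    refine ⟨fun p => fderiv ℝ H p (1, 0),
      (hH.fderiv_right (m := (⊤ : ℕ∞)) (by simp)).clm_apply contDiff_const, fun y => ?_⟩
    rw [iteratedDeriv_succ, hGH y]
    funext x
    have h1 : HasDerivAt (fun x : ℝ => (x, y)) (1, 0) x :=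
      (hasDerivAt_id x).prodMk (hasDerivAt_const x y)
    exact (((hH.differentiable (by simp)) (x, y)).hasFDerivAt.comp_hasDerivAt x h1).deriv

lemma isLittleO_sub_leading_term_fst {G : ℝ × ℝ → ℝ} (hG : ContDiff ℝ (⊤ : ℕ∞) G) {m : ℕ}
    (hz : ∀ y, ∀ i < m, iteratedDeriv i (fun x => G (x, y)) 0 = 0) (y₀ : ℝ) :
    (fun p : ℝ × ℝ => G p - iteratedDeriv m (fun x => G (x, y₀)) 0 / m.factorial * p.1 ^ m)
      =o[𝓝 (0, y₀)] fun p => p.1 ^ m := by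
  set c := iteratedDeriv m (fun x => G (x, y₀)) 0 / m.factorial with hc
  have hGy : ∀ y, ContDiff ℝ (⊤ : ℕ∞) fun x => G (x, y) := fun y => by fun_prop
  have hder : ∀ i x y, iteratedDeriv i (fun x => G (x, y) - c * x ^ m) x =
      iteratedDeriv i (fun x => G (x, y)) x - c * iteratedDeriv i (fun x => x ^ m) x := by
    intro i x y
    rw [iteratedDeriv_fun_sub ((hGy y).contDiffAt.of_le (by exact_mod_cast le_top))
      (by fun_prop), iteratedDeriv_const_mul_field]
  rw [isLittleO_iff]
  intro e he
  have hcont := Metric.continuousAt_iff.1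
    ((continuous_iteratedDeriv_fst hG m).continuousAt (x := (0, y₀))) e he
  obtain ⟨a, ha, hb⟩ := hcont
  filter_upwards [Metric.ball_mem_nhds ((0 : ℝ), y₀) ha] with p hp
  rw [← ball_prod_same, Set.mem_prod] at hp
  have key := abs_le_pow_of_iteratedDeriv_le (m := m) (g := fun x => G (x, p.2) - c * x ^ m)
    (((hGy p.2).of_le (by exact_mod_cast le_top)).sub (by fun_prop))
    (fun i hi => by
      rw [hder, hz _ i hi, iteratedDeriv_fun_pow_zero, if_neg (by omega)]; simp)
    (e := e) (a := |p.1|) he.le (fun x hx => by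
      have hx' : dist (x, p.2) (0, y₀) < a := by
        have h1 : |p.1| < a := by simpa using hp.1
        have h2 : dist p.2 y₀ < a := hp.2
        rw [Prod.dist_eq, max_lt_iff]
        exact ⟨by simpa using hx.trans_lt h1, h2⟩
      have := hb hx'
      rw [hder]
      have hm : iteratedDeriv m (fun x : ℝ => x ^ m) x = m.factorial := by
        simp [Nat.descFactorial_self]
      rw [hm, hc, div_mul_cancel₀ _ (by positivity)]
      exact this.le) p.1 le_rfl
  simpa using key

lemma isLittleO_pow_sub_of_hasDerivAt {X : ℝ → ℝ} {c : ℝ} (hX : HasDerivAt X c 0) (h0 : X 0 = 0)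
    (m : ℕ) : (fun h => X h ^ m - c ^ m * h ^ m) =o[𝓝 0] fun h => h ^ m := by
  have h1 : (fun h => X h - c * h) =o[𝓝 0] fun h => h := by
    simpa [h0, mul_comm] using hX.isLittleO
  have h2 : X =O[𝓝 0] fun h => h := by simpa [h0] using hX.differentiableAt.isBigO_sub
  induction m with
  | zero => simp
  | succ m ih =>
    have h3 := (h2.mul_isLittleO ih).add
      ((isBigO_const_mul_self (c ^ m) (fun h : ℝ => h ^ m) (𝓝 0)).mul_isLittleO h1 |>.congr_right
        fun h => mul_comm _ _)
    exact h3.congr (fun h => by ring) (fun h => by ring)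

lemma isLittleO_two_point_sub {f : ℝ → ℝ → ℝ} {m : ℕ}
    (hf : ContDiff ℝ (⊤ : ℕ∞) (Function.uncurry f))
    (hlow : ∀ Y : ℝ, ∀ j < m, iteratedDeriv j (fun X => ftilde f X Y) 0 = 0)
    {A B : ℝ → ℝ} {a b y : ℝ} (hA : HasDerivAt A a 0) (hB : HasDerivAt B b 0)
    (hA0 : A 0 = y) (hB0 : B 0 = y) :
    (fun h => f (A h) (B h) -
        iteratedDeriv m (fun X => ftilde f X y) 0 / m.factorial * ((a - b) / 2) ^ m * h ^ m)
      =o[𝓝 0] fun h => h ^ m := by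
  have hG : ContDiff ℝ (⊤ : ℕ∞) fun p : ℝ × ℝ => ftilde f p.1 p.2 :=
    hf.comp (f := fun p : ℝ × ℝ => (p.2 + p.1, p.2 - p.1)) (by fun_prop)
  have hX : HasDerivAt (fun h => (A h - B h) / 2) ((a - b) / 2) 0 := (hA.sub hB).div_const 2
  have hX0 : (A 0 - B 0) / 2 = 0 := by simp [hA0, hB0]
  have hlim : Tendsto (fun h => ((A h - B h) / 2, (A h + B h) / 2)) (𝓝 0) (𝓝 (0, y)) := by
    have hc : ContinuousAt (fun h => ((A h - B h) / 2, (A h + B h) / 2)) 0 :=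
      hX.continuousAt.prodMk ((hA.add hB).div_const 2).continuousAt
    simpa [ContinuousAt, hA0, hB0] using hc
  have hXO : (fun h => (A h - B h) / 2) =O[𝓝 0] fun h => h := by
    simpa [hX0] using hX.differentiableAt.isBigO_sub
  have h1 := ((isLittleO_sub_leading_term_fst hG hlow y).comp_tendsto hlim).trans_isBigO
    (hXO.pow m)
  have h2 := (isLittleO_pow_sub_of_hasDerivAt hX hX0 m).const_mul_left
    (iteratedDeriv m (fun X => ftilde f X y) 0 / m.factorial)
  refine (h1.add h2).congr_left fun h => ?_
  have : ftilde f ((A h - B h) / 2) ((A h + B h) / 2) = f (A h) (B h) := by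
    unfold ftilde; congr 1 <;> ring
  simp only [Function.comp_apply, this]
  ring

lemma contDiff_eta (β : ℝ) (ω : Fin 3) : ContDiff ℝ (⊤ : ℕ∞) fun Pe => eta β Pe ω := by
  fin_cases ω <;> simp [eta] <;> fun_prop

lemma contDiff_nu (β : ℝ) (ω : Fin 3) : ContDiff ℝ (⊤ : ℕ∞) fun Pe => nu β Pe ω := by
  fin_cases ω <;> simp [nu] <;> fun_prop

lemma eta_zero (β : ℝ) (ω : Fin 3) : eta β 0 ω = nu β 0 ω := by
  simp [eta, nu]

lemma nu_zero_ne_zero {β : ℝ} (hβ0 : 0 < β) (hβ1 : β < 1) (ω : Fin 3) : nu β 0 ω ≠ 0 := by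
  have : 1 - β ≠ 0 := by linarith
  fin_cases ω <;> simp [nu, hβ0.ne', this]

lemma eta_neg (β Pe : ℝ) (ω : Fin 3) : eta β (-Pe) ω = eta β Pe ω.rev := by
  fin_cases ω <;> simp [eta, sub_eq_add_neg, neg_div]

lemma nu_neg (β Pe : ℝ) (ω : Fin 3) : nu β (-Pe) ω = nu β Pe ω.rev := by
  fin_cases ω <;> simp [nu, sub_eq_add_neg, neg_div]

lemma one_sub_rev_cast (ω : Fin 3) : (1 : ℤ) - ((ω.rev : ℕ) : ℤ) = -(1 - ((ω : ℕ) : ℤ)) := by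
  fin_cases ω <;> simp

lemma eta_sub_nu_isBigO (β c : ℝ) (ω : Fin 3) :
    (fun h => eta β (c * h) ω - nu β (c * h) ω) =O[𝓝 0] fun h => h := by
  have hd : DifferentiableAt ℝ (fun h => eta β (c * h) ω - nu β (c * h) ω) 0 :=
    (((contDiff_eta β ω).sub (contDiff_nu β ω)).comp
      (f := fun h : ℝ => c * h) (by fun_prop)).differentiable (by simp) 0
  simpa [eta_zero] using hd.isBigO_sub

lemma rhoHat_neg (β Pe r h : ℝ) (ρ₀ : ℝ → ℝ) {K : ℕ} (j : ℤ) (u : Fin K → Fin 3) :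
    rhoHat β (-Pe) r (-h) ρ₀ j u = rhoHat β Pe r h ρ₀ (-j) fun d => (u d).rev := by
  have hs : ∑ d, (1 - (((u d).rev : ℕ) : ℝ)) = -∑ d, (1 - ((u d : ℕ) : ℝ)) := by
    rw [← Finset.sum_neg_distrib]
    exact Finset.sum_congr rfl fun d _ => by exact_mod_cast one_sub_rev_cast (u d)
  simp only [rhoHat, eta_neg, nu_neg, hs]
  congr 2
  push_cast
  ring

lemma Floc_neg (β Pe r h : ℝ) (ρ₀ : ℝ → ℝ) (f : ℝ → ℝ → ℝ) {K : ℕ} (j : ℤ) (ω u₀ : Fin 3)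
    (u : Fin K → Fin 3) :
    Floc β (-Pe) r (-h) ρ₀ f j ω u₀ u =
      Floc β Pe r h ρ₀ f (-j) ω.rev u₀.rev fun d => (u d).rev := by
  have hj : -(j + 1 - ((u₀ : ℕ) : ℤ)) = -j + 1 - ((u₀.rev : ℕ) : ℤ) := by
    have := one_sub_rev_cast u₀
    linarith
  simp only [Floc, eta_neg, nu_neg, rhoHat_neg, hj]

lemma Ksum_neg (D v β r : ℝ) (k : ℕ) (ρ₀ : ℝ → ℝ) (f : ℝ → ℝ → ℝ) (ε δ : ℝ) (m : ℕ) (h : ℝ) :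
    Ksum D v β r k ρ₀ f ε δ m (-h) = -Ksum D v β r k ρ₀ f ε δ m h := by
  have hPe : v * -h / D = -(v * h / D) := by ring
  simp only [Ksum, hPe, Floc_neg, eta_neg, nu_neg, ← one_sub_rev_cast, neg_zero]
  rw [neg_mul]
  congr 2
  refine Fintype.sum_equiv Fin.revPerm _ _ fun ω => ?_
  refine Fintype.sum_equiv Fin.revPerm _ _ fun u₀ => ?_
  exact Fintype.sum_equiv (Equiv.piCongrRight fun _ => Fin.revPerm) _ _ fun u => rfl

section Smoothness

variable {β : ℝ}

lemma contDiffAt_eta_div_nu (hβ0 : 0 < β) (hβ1 : β < 1) (c : ℝ) (ω : Fin 3) :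
    ContDiffAt ℝ (⊤ : ℕ∞) (fun h => eta β (c * h) ω / nu β (c * h) ω) 0 := by
  refine ContDiffAt.div ?_ ?_ (by simpa using nu_zero_ne_zero hβ0 hβ1 ω)
  · exact ((contDiff_eta β ω).comp (f := fun h : ℝ => c * h) (by fun_prop)).contDiffAt
  · exact ((contDiff_nu β ω).comp (f := fun h : ℝ => c * h) (by fun_prop)).contDiffAt

lemma contDiffAt_rhoHat (hβ0 : 0 < β) (hβ1 : β < 1) (c r : ℝ) {ρ₀ : ℝ → ℝ}
    (hρ : ContDiff ℝ (⊤ : ℕ∞) ρ₀) {K : ℕ} (j : ℤ) (u : Fin K → Fin 3) :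
    ContDiffAt ℝ (⊤ : ℕ∞) (fun h => rhoHat β (c * h) r h ρ₀ j u) 0 := by
  refine ContDiffAt.mul (contDiffAt_prod fun d _ => contDiffAt_eta_div_nu hβ0 hβ1 c (u d)) ?_
  exact (hρ.comp (f := fun h : ℝ => r + ((j : ℝ) + ∑ d, (1 - ((u d : ℕ) : ℝ))) * h)
    (by fun_prop)).contDiffAt

lemma contDiffAt_Floc (hβ0 : 0 < β) (hβ1 : β < 1) (c r : ℝ) {ρ₀ : ℝ → ℝ}
    (hρ : ContDiff ℝ (⊤ : ℕ∞) ρ₀) {f : ℝ → ℝ → ℝ}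
    (hf : ContDiff ℝ (⊤ : ℕ∞) (Function.uncurry f)) {K : ℕ} (j : ℤ) (ω u₀ : Fin 3)
    (u : Fin K → Fin 3) :
    ContDiffAt ℝ (⊤ : ℕ∞) (fun h => Floc β (c * h) r h ρ₀ f j ω u₀ u) 0 :=
  hf.contDiffAt.comp (0 : ℝ)
    (((contDiffAt_eta_div_nu hβ0 hβ1 c ω).mul (contDiffAt_rhoHat hβ0 hβ1 c r hρ j u)).prodMk
      ((contDiffAt_eta_div_nu hβ0 hβ1 c u₀).mul
        (contDiffAt_rhoHat hβ0 hβ1 c r hρ (j + 1 - ((u₀ : ℕ) : ℤ)) u)))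

lemma contDiffAt_Ksum (hβ0 : 0 < β) (hβ1 : β < 1) (D v r : ℝ) (k : ℕ) {ρ₀ : ℝ → ℝ}
    (hρ : ContDiff ℝ (⊤ : ℕ∞) ρ₀) {f : ℝ → ℝ → ℝ}
    (hf : ContDiff ℝ (⊤ : ℕ∞) (Function.uncurry f)) (ε δ : ℝ) (m : ℕ) :
    ContDiffAt ℝ (⊤ : ℕ∞) (Ksum D v β r k ρ₀ f ε δ m) 0 := by
  have hη : ∀ ω, ContDiffAt ℝ (⊤ : ℕ∞) (fun h => eta β (v / D * h) ω) 0 := fun ω =>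
    ((contDiff_eta β ω).comp (f := fun h : ℝ => v / D * h) (by fun_prop)).contDiffAt
  have hν : ∀ ω, ContDiffAt ℝ (⊤ : ℕ∞) (fun h => nu β (v / D * h) ω) 0 := fun ω =>
    ((contDiff_nu β ω).comp (f := fun h : ℝ => v / D * h) (by fun_prop)).contDiffAt
  unfold Ksum
  simp only [mul_div_right_comm v]
  refine contDiffAt_id.mul (ContDiffAt.sum fun ω _ => ContDiffAt.sum fun u₀ _ =>
    ContDiffAt.sum fun u _ => ?_)
  exact (((hη ω).add (contDiffAt_const.mul (hν ω))).mul
    ((hν u₀).mul (contDiffAt_prod fun d _ => hν (u d)))).mul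
    ((contDiffAt_Floc hβ0 hβ1 _ r hρ hf _ ω u₀ u).add
      (contDiffAt_const.mul (contDiffAt_Floc hβ0 hβ1 _ r hρ hf _ ω u₀ u)))

end Smoothness

/-- The leading coefficient of `Floc` at order `m` does not depend on the site `j`. -/
lemma exists_isLittleO_Floc_sub {β : ℝ} (hβ0 : 0 < β) (hβ1 : β < 1) (c r : ℝ) {ρ₀ : ℝ → ℝ}
    (hρ : ContDiff ℝ (⊤ : ℕ∞) ρ₀) {f : ℝ → ℝ → ℝ}
    (hf : ContDiff ℝ (⊤ : ℕ∞) (Function.uncurry f)) {m : ℕ}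
    (hlow : ∀ Y : ℝ, ∀ j < m, iteratedDeriv j (fun X => ftilde f X Y) 0 = 0)
    {K : ℕ} (ω u₀ : Fin 3) (u : Fin K → Fin 3) :
    ∃ a : ℝ, ∀ j : ℤ,
      (fun h => Floc β (c * h) r h ρ₀ f j ω u₀ u - a * h ^ m) =o[𝓝 0] fun h => h ^ m := by
  set q : Fin 3 → ℝ → ℝ := fun ω h => eta β (c * h) ω / nu β (c * h) ω with hq
  have hqd : ∀ ω, DifferentiableAt ℝ (q ω) 0 := fun ω =>
    (contDiffAt_eta_div_nu hβ0 hβ1 c ω).differentiableAt (by simp)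
  have hq0 : ∀ ω, q ω 0 = 1 := fun ω => by
    simp [hq, eta_zero, div_self (nu_zero_ne_zero hβ0 hβ1 ω)]
  set Q : Fin 3 → ℝ → ℝ := fun ω h => q ω h * ∏ d, q (u d) h with hQ
  have hQd : ∀ ω, DifferentiableAt ℝ (Q ω) 0 := fun ω =>
    (hqd ω).mul (DifferentiableAt.fun_finsetProd fun d _ => hqd (u d))
  have hQ0 : ∀ ω, Q ω 0 = 1 := fun ω => by simp [hQ, hq0]
  set σ : ℝ := ∑ d, (1 - ((u d : ℕ) : ℝ))
  have hval : ∀ ω (j : ℤ), HasDerivAt (fun h => q ω h * rhoHat β (c * h) r h ρ₀ j u)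
      (deriv (Q ω) 0 * ρ₀ r + (j + σ) * deriv ρ₀ r) 0 := by
    intro ω j
    have hlin : HasDerivAt (fun h : ℝ => r + ((j : ℝ) + σ) * h) ((j : ℝ) + σ) 0 := by
      simpa using ((hasDerivAt_id (0 : ℝ)).const_mul ((j : ℝ) + σ)).const_add r
    have hρd : HasDerivAt ρ₀ (deriv ρ₀ r) (r + ((j : ℝ) + σ) * 0) := by
      simpa using (hρ.differentiable (by simp) r).hasDerivAt
    have := (hQd ω).hasDerivAt.mul (hρd.comp 0 hlin)
    refine (this.congr_deriv ?_).congr_of_eventuallyEq (Eventually.of_forall fun h => ?_)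
    · simp only [Function.comp_apply, hQ0, mul_zero, add_zero]
      ring
    · simp [hQ, rhoHat, hq, σ, mul_assoc]
  have hzero : ∀ ω (j : ℤ), q ω 0 * rhoHat β (c * 0) r 0 ρ₀ j u = ρ₀ r := by
    intro ω j
    simp [hq0, rhoHat, eta_zero, div_self (nu_zero_ne_zero hβ0 hβ1 _)]
  refine ⟨iteratedDeriv m (fun X => ftilde f X (ρ₀ r)) 0 / m.factorial *
    ((deriv (Q ω) 0 * ρ₀ r - (deriv (Q u₀) 0 * ρ₀ r + (1 - ((u₀ : ℕ) : ℝ)) * deriv ρ₀ r)) / 2) ^ m,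
    fun j => ?_⟩
  refine (isLittleO_two_point_sub hf hlow (hval ω j) (hval u₀ (j + 1 - ((u₀ : ℕ) : ℤ)))
    (hzero ω j) (hzero u₀ _)).congr_left fun h => ?_
  push_cast
  simp only [Floc, hq]
  ring

lemma isLittleO_Ksum {β : ℝ} (hβ0 : 0 < β) (hβ1 : β < 1) (D v r : ℝ) (k : ℕ) {ρ₀ : ℝ → ℝ}
    (hρ : ContDiff ℝ (⊤ : ℕ∞) ρ₀) {f : ℝ → ℝ → ℝ}
    (hf : ContDiff ℝ (⊤ : ℕ∞) (Function.uncurry f)) {m : ℕ}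
    (hlow : ∀ Y : ℝ, ∀ j < m, iteratedDeriv j (fun X => ftilde f X Y) 0 = 0) (hmo : Odd m) :
    Ksum D v β r k ρ₀ f 1 (-1) m =o[𝓝 0] fun h => h ^ (m + 2) := by
  have hν : ∀ ω, ContinuousAt (fun h => nu β (v / D * h) ω) 0 := fun ω =>
    ((contDiff_nu β ω).continuous.comp (f := fun h : ℝ => v / D * h) (by fun_prop)).continuousAt
  unfold Ksum
  simp only [mul_div_right_comm v, hmo.neg_one_pow]
  have hsum : ∀ (ω u₀ : Fin 3) (u : Fin (k - 1) → Fin 3),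
      (fun h => (eta β (v / D * h) ω + -1 * nu β (v / D * h) ω) *
        (nu β (v / D * h) u₀ * ∏ d, nu β (v / D * h) (u d)) *
        (Floc β (v / D * h) r h ρ₀ f 0 ω u₀ u +
          1 * -1 * Floc β (v / D * h) r h ρ₀ f (1 - ((ω : ℕ) : ℤ)) ω u₀ u))
      =o[𝓝 0] fun h => h ^ (m + 1) := by
    intro ω u₀ u
    obtain ⟨a, ha⟩ := exists_isLittleO_Floc_sub hβ0 hβ1 (v / D) r hρ hf hlow ω u₀ u
    have hw : (fun h => nu β (v / D * h) u₀ * ∏ d, nu β (v / D * h) (u d)) =O[𝓝 0]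
        fun _ => (1 : ℝ) :=
      ((hν u₀).mul (tendsto_finsetProd _ fun d _ => hν (u d))).isBigO_one ℝ
    have := ((eta_sub_nu_isBigO β (v / D) ω).mul hw).mul_isLittleO
      ((ha 0).sub (ha (1 - ((ω : ℕ) : ℤ))))
    exact this.congr (fun h => by ring) (fun h => by ring)
  have := (isBigO_refl (fun h : ℝ => h) (𝓝 0)).mul_isLittleO
    (IsLittleO.fun_sum (s := Finset.univ) fun ω _ => IsLittleO.fun_sum (s := Finset.univ) fun u₀ _ =>
      IsLittleO.fun_sum (s := Finset.univ) fun u _ => hsum ω u₀ u)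
  exact this.congr_right fun h => by ring

/-- LOE, Case II with m odd, ε = 1 and δ = −1: ⟨A⟩(Δr) = O(Δr^(m+1)). -/
theorem LOE_caseII_second
    (D v β r : ℝ) (k : ℕ) (ρ₀ : ℝ → ℝ) (f : ℝ → ℝ → ℝ)
    (ε δ : ℝ) (m : ℕ) (Chat : ℝ → ℝ)
    (hD : 0 < D) (hβ0 : 0 < β) (hβ1 : β < 1) (hk : 1 ≤ k)
    (hρ : ContDiff ℝ (⊤ : ℕ∞) ρ₀) (hρpos : ∀ x, 0 < ρ₀ x)
    (hf : ContDiff ℝ (⊤ : ℕ∞) (Function.uncurry f))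
    (hε : ε = 1 ∨ ε = -1) (hδ : δ = 1 ∨ δ = -1)
    (hsym : ∀ x y, f y x = (-1 : ℝ) ^ m * f x y)
    (hlow : ∀ Y : ℝ, ∀ j < m, iteratedDeriv j (fun X => ftilde f X Y) 0 = 0)
    (hchar : ∀ Y : ℝ, iteratedDeriv m (fun X => ftilde f X Y) 0 = (m.factorial : ℝ) * Chat Y)
    (hCbdd : ∃ M : ℝ, ∀ y, |Chat y| ≤ M) (hCne : ∀ y, Chat y ≠ 0)
    (hmo : Odd m) (hε1 : ε = 1) (hδm1 : δ = -1) :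
    ∃ C > 0, ∃ Δ₀ > 0, ∀ Δr : ℝ, 0 < Δr → Δr < Δ₀ →
      |avgA D v β r k ρ₀ f ε δ m Δr| ≤ C * Δr ^ (m + 1) := by
  subst hε1 hδm1
  have hpar : ∀ h, Ksum D v β r k ρ₀ f 1 (-1) m (-h) =
      (-1) ^ (m + 2) * Ksum D v β r k ρ₀ f 1 (-1) m h := fun h => by
    rw [Ksum_neg, pow_add, hmo.neg_one_pow]
    ring
  have hO := isBigO_pow_add_two_of_parity
    (contDiffAt_infty.1 (contDiffAt_Ksum hβ0 hβ1 D v r k hρ hf 1 (-1) m) _)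
    (isLittleO_Ksum hβ0 hβ1 D v r k hρ hf hlow hmo) hpar
  obtain ⟨C, hC, hbound⟩ := hO.exists_pos
  obtain ⟨Δ₀, hΔ₀, hball⟩ := Metric.eventually_nhds_iff.1 hbound.bound
  refine ⟨C * (2 * D / β), by positivity, Δ₀, hΔ₀, fun h hh hhΔ => ?_⟩
  have hK := hball (y := h) (by simpa [abs_of_pos hh] using hhΔ)
  rw [Real.norm_eq_abs, Real.norm_eq_abs, abs_of_pos (pow_pos hh _)] at hK
  have hτ : 0 < β * h ^ 2 / (2 * D) * h := by positivity
  rw [avgA, abs_div, abs_of_pos hτ, div_le_iff₀ hτ]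
  refine hK.trans_eq ?_
  field_simp
  ring
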